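/- Under the hypotheses of the preceding setting (T_k = L_k D_k L_k^T a Jacobi matrix built from positive γ_0,…,γ_{k−1} and δ_1,…,δ_{k−1}; β_k = √δ_k/γ_{k−1} with δ_k > 0; 0 < μ < θ_1^{(k)}; φ_0 = 1, φ_j^{−1} = 1 + φ_{j−1}^{−1} δ_j for j ≤ k; α_{k+1}^{(μ)} = μ + β_k² e_k^T(T_k − μI)^{−1}e_k; γ_k^{(μ)} = (α_{k+1}^{(μ)} − δ_k/γ_{k−1})^{−1}; η_{i,k}^{(μ)} = (β_k s_{k,i}^{(k)})²/(θ_i^{(k)} − μ)), the relative distance between φ_k/μ and γ_k^{(μ)} satisfies (φ_k/μ − γ_k^{(μ)})/γ_k^{(μ)} = φ_k [ (μ/θ_1^{(k)})² η_{1,k}^{(μ)}/μ + Σ_{i=2}^{k} (β_k s_{k,i}^{(k)}/θ_i^{(k)})² μ/(θ_i^{(k)} − μ) ]. -/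

import Mathlib

open Matrix Finset

section SpectralCalculus

variable {n : Type*} [Fintype n] [DecidableEq n]

theorem conj_diagonal_apply (S : Matrix n n ℝ) (d : n → ℝ) (i j : n) :
    (S * Matrix.diagonal d * Sᵀ) i j = ∑ l, S i l * d l * S j l := by
  simp [Matrix.mul_apply, Matrix.diagonal_apply]

theorem conj_diagonal_mul_conj_diagonal {S : Matrix n n ℝ} (hS : S * Sᵀ = 1) (d e : n → ℝ) :
    (S * Matrix.diagonal d * Sᵀ) * (S * Matrix.diagonal e * Sᵀ)
      = S * Matrix.diagonal (fun i => d i * e i) * Sᵀ := by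
  have hS' : Sᵀ * S = 1 := mul_eq_one_comm.mp hS
  calc (S * Matrix.diagonal d * Sᵀ) * (S * Matrix.diagonal e * Sᵀ)
      = S * Matrix.diagonal d * (Sᵀ * S) * Matrix.diagonal e * Sᵀ := by
        simp only [Matrix.mul_assoc]
    _ = _ := by
        rw [hS', Matrix.mul_one, Matrix.mul_assoc S, Matrix.diagonal_mul_diagonal]

theorem conj_diagonal_mul_inv {S : Matrix n n ℝ} (hS : S * Sᵀ = 1) {d : n → ℝ}
    (hd : ∀ i, d i ≠ 0) :
    (S * Matrix.diagonal d * Sᵀ) * (S * Matrix.diagonal (fun i => (d i)⁻¹) * Sᵀ) = 1 := by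
  rw [conj_diagonal_mul_conj_diagonal hS]
  simp [hd, hS]

theorem conj_diagonal_sub_smul_one {S : Matrix n n ℝ} (hS : S * Sᵀ = 1) (d : n → ℝ) (μ : ℝ) :
    S * Matrix.diagonal d * Sᵀ - μ • 1 = S * Matrix.diagonal (fun i => d i - μ) * Sᵀ := by
  have h : Matrix.diagonal (fun i => d i - μ) = Matrix.diagonal d - μ • (1 : Matrix n n ℝ) := by
    ext i j
    by_cases hij : i = j <;> simp [hij]
  rw [h, Matrix.mul_sub, Matrix.sub_mul, Matrix.mul_smul, Matrix.smul_mul, Matrix.mul_one, hS]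

/-- A column of `S d Sᵀ` has squared Euclidean norm given by the diagonal entry of `S d² Sᵀ`. -/
theorem sum_sq_conj_diagonal_apply {S : Matrix n n ℝ} (hS : S * Sᵀ = 1) (d : n → ℝ) (j : n) :
    ∑ i, (S * Matrix.diagonal d * Sᵀ) i j ^ 2 = ∑ l, S j l ^ 2 * d l ^ 2 := by
  have h := congrFun (congrFun (conj_diagonal_mul_conj_diagonal hS d d) j) j
  rw [Matrix.mul_apply, conj_diagonal_apply] at h
  convert h using 2 with i _ l _
  · have : (S * Matrix.diagonal d * Sᵀ) j i = (S * Matrix.diagonal d * Sᵀ) i j := by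
      simp only [conj_diagonal_apply]
      exact Finset.sum_congr rfl fun l _ => by ring
    rw [this, sq]
  · ring

end SpectralCalculus

section Bidiagonal

variable {k : ℕ} {L : Matrix (Fin (k + 1)) (Fin (k + 1)) ℝ}

theorem isUnit_det_of_unit_bidiagonal (hLdiag : ∀ i, L i i = 1)
    (hLzero : ∀ i j : Fin (k + 1), (i : ℕ) ≠ (j : ℕ) → (i : ℕ) ≠ (j : ℕ) + 1 → L i j = 0) :
    IsUnit L.det := by
  rw [Matrix.det_of_isLowerTriangular L]
  · simp [hLdiag]
  · intro i j hij
    have hij : i < j := hij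
    exact hLzero i j (by omega) (by omega)

theorem bidiagonal_mulVec_single_last (hLdiag : ∀ i, L i i = 1)
    (hLzero : ∀ i j : Fin (k + 1), (i : ℕ) ≠ (j : ℕ) → (i : ℕ) ≠ (j : ℕ) + 1 → L i j = 0) :
    L *ᵥ Pi.single (Fin.last k) 1 = Pi.single (Fin.last k) 1 := by
  ext i
  rw [Matrix.mulVec_single_one, Matrix.col_apply]
  rcases eq_or_ne i (Fin.last k) with rfl | hi
  · simp [hLdiag]
  · rw [Pi.single_eq_of_ne hi]
    have := Fin.val_lt_last hi
    exact hLzero i (Fin.last k) (by rw [Fin.val_last]; omega) (by rw [Fin.val_last]; omega)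

theorem bidiagonal_transpose_mulVec_castSucc (hLdiag : ∀ i, L i i = 1)
    (hLzero : ∀ i j : Fin (k + 1), (i : ℕ) ≠ (j : ℕ) → (i : ℕ) ≠ (j : ℕ) + 1 → L i j = 0)
    (w : Fin (k + 1) → ℝ) (i : Fin k) :
    (Lᵀ *ᵥ w) i.castSucc = w i.castSucc + L i.succ i.castSucc * w i.succ := by
  simp only [Matrix.mulVec, dotProduct, Matrix.transpose_apply]
  rw [Finset.sum_eq_add_of_mem i.castSucc i.succ (mem_univ _) (mem_univ _)
    (Fin.castSucc_lt_succ).ne]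
  · rw [hLdiag, one_mul]
  · rintro j - ⟨h₁, h₂⟩
    rw [hLzero j i.castSucc, zero_mul]
    · exact fun h => h₁ (Fin.ext h)
    · exact fun h => h₂ (Fin.ext (by simpa using h))

theorem bidiagonal_transpose_mulVec_last (hLdiag : ∀ i, L i i = 1)
    (hLzero : ∀ i j : Fin (k + 1), (i : ℕ) ≠ (j : ℕ) → (i : ℕ) ≠ (j : ℕ) + 1 → L i j = 0)
    (w : Fin (k + 1) → ℝ) :
    (Lᵀ *ᵥ w) (Fin.last k) = w (Fin.last k) := by
  simp only [Matrix.mulVec, dotProduct, Matrix.transpose_apply]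
  rw [Finset.sum_eq_single (Fin.last k)]
  · rw [hLdiag, one_mul]
  · intro j _ hj
    have := Fin.val_lt_last hj
    rw [hLzero j (Fin.last k) (by rw [Fin.val_last]; omega) (by rw [Fin.val_last]; omega),
      zero_mul]
  · simp

theorem transpose_mulVec_eq_of_ldl_mulVec_eq {γ : Fin (k + 1) → ℝ} (hγ : ∀ i, 0 < γ i)
    (hLdiag : ∀ i, L i i = 1)
    (hLzero : ∀ i j : Fin (k + 1), (i : ℕ) ≠ (j : ℕ) → (i : ℕ) ≠ (j : ℕ) + 1 → L i j = 0)
    {w : Fin (k + 1) → ℝ}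
    (hw : (L * Matrix.diagonal (fun i => (γ i)⁻¹) * Lᵀ) *ᵥ w = Pi.single (Fin.last k) 1) :
    Lᵀ *ᵥ w = Pi.single (Fin.last k) (γ (Fin.last k)) := by
  have hinj : Function.Injective L.mulVec := Matrix.mulVec_injective_iff_isUnit.mpr
    ((Matrix.isUnit_iff_isUnit_det L).mpr (isUnit_det_of_unit_bidiagonal hLdiag hLzero))
  have h : Matrix.diagonal (fun i => (γ i)⁻¹) *ᵥ (Lᵀ *ᵥ w) = Pi.single (Fin.last k) 1 := by
    apply hinj
    rw [bidiagonal_mulVec_single_last hLdiag hLzero, ← hw, Matrix.mulVec_mulVec,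
      Matrix.mulVec_mulVec, Matrix.mul_assoc]
  ext i
  have hi := congrFun h i
  rw [Matrix.mulVec_diagonal, inv_mul_eq_iff_eq_mul₀ (hγ i).ne'] at hi
  rw [hi]
  rcases eq_or_ne i (Fin.last k) with rfl | hne
  · simp
  · simp [hne]

end Bidiagonal

/-- If consecutive entries satisfy `wᵢ² = δᵢ wᵢ₊₁²` and `ψⱼ₊₁ = 1 + ψⱼ δⱼ`, then the partial sums
of `w²` are `wⱼ² ψⱼ`. -/
theorem sum_Iic_sq_eq_sq_mul {k : ℕ} {δ : Fin k → ℝ} {w ψ : Fin (k + 1) → ℝ}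
    (hw : ∀ i : Fin k, w i.castSucc ^ 2 = δ i * w i.succ ^ 2) (hψ0 : ψ 0 = 1)
    (hψ : ∀ i : Fin k, ψ i.succ = 1 + ψ i.castSucc * δ i) (j : Fin (k + 1)) :
    ∑ i ∈ Finset.Iic j, w i ^ 2 = w j ^ 2 * ψ j := by
  induction j using Fin.induction with
  | zero =>
    have : Finset.Iic (0 : Fin (k + 1)) = {0} := by ext i; simp
    simp [this, hψ0]
  | succ i ih =>
    have : Finset.Iic i.succ = insert i.succ (Finset.Iic i.castSucc) := by
      ext j
      simp only [Finset.mem_Iic, Finset.mem_insert, Fin.le_def, Fin.ext_iff, Fin.val_succ,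
        Fin.val_castSucc]
      omega
    rw [this, Finset.sum_insert (by simp [Fin.le_def]), ih, hψ, hw]
    ring

theorem inv_sub_eq_inv_add_div_sq_add {θ μ : ℝ} (hθ : θ ≠ 0) (h : θ - μ ≠ 0) :
    (θ - μ)⁻¹ = θ⁻¹ + μ * (θ⁻¹) ^ 2 + μ * ((θ⁻¹) ^ 2 * (μ / (θ - μ))) := by
  field_simp
  ring



/-- the relative distance between the simple upper bound coefficient
`φ_k/μ` and the Gauss–Radau coefficient `γ_k^{(μ)}` satisfies
`(φ_k/μ - γ_k^{(μ)})/γ_k^{(μ)} = φ_k [ (μ/θ₁)² η_{1,k}^{(μ)}/μ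
  + ∑_{i≥2} (β_k s_{k,i}/θᵢ)² μ/(θᵢ - μ) ]`. -/
theorem stmt16
    (k : ℕ) (γ : Fin (k + 1) → ℝ) (δ : Fin k → ℝ) (δk μ : ℝ)
    (hγ : ∀ i, 0 < γ i) (hδ : ∀ i, 0 < δ i) (hδk : 0 < δk)
    (L T S : Matrix (Fin (k + 1)) (Fin (k + 1)) ℝ)
    (θ : Fin (k + 1) → ℝ) (φ : Fin (k + 2) → ℝ)
    (hLdiag : ∀ i, L i i = 1)
    (hLsub : ∀ i : Fin k, L i.succ i.castSucc = Real.sqrt (δ i))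
    (hLzero : ∀ i j : Fin (k + 1), (i : ℕ) ≠ (j : ℕ) → (i : ℕ) ≠ (j : ℕ) + 1 → L i j = 0)
    (hT : T = L * Matrix.diagonal (fun i => (γ i)⁻¹) * Lᵀ)
    (hθ : StrictMono θ) (hS : S * Sᵀ = 1) (hspec : T = S * Matrix.diagonal θ * Sᵀ)
    (β : ℝ) (hβ : β = Real.sqrt δk / γ (Fin.last k))
    (hφ0 : φ 0 = 1)
    (hφ : ∀ j : Fin (k + 1), (φ j.succ)⁻¹ = 1 + (φ j.castSucc)⁻¹ *
      (Fin.snoc (fun i : Fin k => δ i) δk : Fin (k + 1) → ℝ) j)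
    (hμ0 : 0 < μ) (hμ : μ < θ 0)
    (η : Fin (k + 1) → ℝ)
    (hη : ∀ i, η i = (β * S (Fin.last k) i) ^ 2 / (θ i - μ))
    (αμ : ℝ)
    (hαμ : αμ = μ + β ^ 2 *
      (Pi.single (Fin.last k) 1 ⬝ᵥ (T - μ • 1)⁻¹ *ᵥ Pi.single (Fin.last k) 1))
    (γμ : ℝ) (hγμ : γμ = (αμ - δk / γ (Fin.last k))⁻¹) :
    (φ (Fin.last (k + 1)) / μ - γμ) / γμ
      = φ (Fin.last (k + 1)) *
        ((μ / θ 0) ^ 2 * η 0 / μ +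
          ∑ i ∈ Finset.Ioi (0 : Fin (k + 1)),
            (β * S (Fin.last k) i / θ i) ^ 2 * (μ / (θ i - μ))) := by
  have hθpos : ∀ i, 0 < θ i := fun i =>
    (hμ0.trans hμ).trans_le (hθ.monotone (Fin.zero_le i))
  have hθμ : ∀ i, 0 < θ i - μ := fun i =>
    sub_pos.mpr (hμ.trans_le (hθ.monotone (Fin.zero_le i)))
  set l := Fin.last k with hl
  set w : Fin (k + 1) → ℝ :=
    (S * Matrix.diagonal (fun i => (θ i)⁻¹) * Sᵀ) *ᵥ Pi.single l 1 with hw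
  have hw_apply (i) : w i = (S * Matrix.diagonal (fun i => (θ i)⁻¹) * Sᵀ) i l := by
    rw [hw, Matrix.mulVec_single_one, Matrix.col_apply]
  have hLw : Lᵀ *ᵥ w = Pi.single l (γ l) := by
    refine transpose_mulVec_eq_of_ldl_mulVec_eq hγ hLdiag hLzero ?_
    rw [← hT, hspec, hw, Matrix.mulVec_mulVec, conj_diagonal_mul_inv hS fun i => (hθpos i).ne',
      Matrix.one_mulVec]
  have hw_last : w l = γ l := by
    rw [hl, ← bidiagonal_transpose_mulVec_last hLdiag hLzero w, hLw, Pi.single_eq_same]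
  have hw_rec (i : Fin k) : w i.castSucc ^ 2 = δ i * w i.succ ^ 2 := by
    have h := bidiagonal_transpose_mulVec_castSucc hLdiag hLzero w i
    rw [hLw, Pi.single_eq_of_ne (Fin.castSucc_lt_last i).ne, hLsub] at h
    rw [eq_neg_of_add_eq_zero_left h.symm, neg_sq, mul_pow, Real.sq_sqrt (hδ i).le]
  have hψ := sum_Iic_sq_eq_sq_mul (ψ := fun j => (φ j.castSucc)⁻¹) hw_rec (by simp [hφ0])
    (fun i => by simpa using hφ i.castSucc) l
  have hIic : Finset.Iic l = Finset.univ := by ext i; simp [hl, Fin.le_last]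
  rw [hIic, hw_last] at hψ
  have hφ_last := hφ l
  rw [hl, Fin.snoc_last, ← hl, Fin.succ_last] at hφ_last
  have hβsq : β ^ 2 * γ l ^ 2 = δk := by
    rw [hβ, div_pow, Real.sq_sqrt hδk.le, div_mul_cancel₀ _ (pow_ne_zero 2 (hγ l).ne')]
  have hsum₁ : β ^ 2 * ∑ i, S l i ^ 2 * (θ i)⁻¹ = δk / γ l := by
    have : ∑ i, S l i ^ 2 * (θ i)⁻¹ = γ l := by
      rw [← hw_last, hw_apply, conj_diagonal_apply]
      exact Finset.sum_congr rfl fun i _ => by ring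
    rw [this, eq_div_iff (hγ l).ne', ← hβsq]
    ring
  have hsum₂ : β ^ 2 * ∑ i, S l i ^ 2 * (θ i)⁻¹ ^ 2 = (φ (Fin.last (k + 1)))⁻¹ - 1 := by
    rw [← sum_sq_conj_diagonal_apply hS]
    simp only [← hw_apply]
    rw [hψ, hφ_last, ← hβsq]
    ring
  set R := ∑ i, (β * S l i / θ i) ^ 2 * (μ / (θ i - μ)) with hR
  have hR_nonneg : 0 ≤ R := Finset.sum_nonneg fun i _ =>
    mul_nonneg (sq_nonneg _) (div_pos hμ0 (hθμ i)).le
  have hφ_pos : 0 < (φ (Fin.last (k + 1)))⁻¹ := by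
    have : 0 ≤ β ^ 2 * ∑ i, S l i ^ 2 * (θ i)⁻¹ ^ 2 := by positivity
    linarith
  have hquad : β ^ 2 * (Pi.single l 1 ⬝ᵥ (T - μ • 1)⁻¹ *ᵥ Pi.single l 1)
      = δk / γ l + μ * ((φ (Fin.last (k + 1)))⁻¹ - 1) + μ * R := by
    rw [hspec, conj_diagonal_sub_smul_one hS,
      Matrix.inv_eq_right_inv (conj_diagonal_mul_inv hS fun i => (hθμ i).ne'),
      Matrix.mulVec_single_one, single_one_dotProduct, Matrix.col_apply, conj_diagonal_apply,
      ← hsum₁, ← hsum₂, hR]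
    simp only [Finset.mul_sum, ← Finset.sum_add_distrib]
    refine Finset.sum_congr rfl fun i _ => ?_
    rw [inv_sub_eq_inv_add_div_sq_add (hθpos i).ne' (hθμ i).ne']
    ring
  have hγμ_inv : γμ = (μ * ((φ (Fin.last (k + 1)))⁻¹ + R))⁻¹ := by
    rw [hγμ, hαμ, hquad]
    ring
  have hrhs : (μ / θ 0) ^ 2 * η 0 / μ + ∑ i ∈ Finset.Ioi (0 : Fin (k + 1)),
      (β * S l i / θ i) ^ 2 * (μ / (θ i - μ)) = R := by
    have hunion : (Finset.univ : Finset (Fin (k + 1))) = insert 0 (Finset.Ioi 0) := by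
      ext i
      simp [em]
    rw [hR, hunion, Finset.sum_insert (by simp), hη]
    congr 1
    have := (hθpos 0).ne'
    have := (hθμ 0).ne'
    field_simp
  rw [hrhs, hγμ_inv]
  have := (inv_pos.mp hφ_pos).ne'
  have hne : (φ (Fin.last (k + 1)))⁻¹ + R ≠ 0 := by positivity
  rw [sub_div, div_self (inv_ne_zero (mul_ne_zero hμ0.ne' hne)), div_inv_eq_mul]
  field_simp
  ring
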